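/- Let H and K be Hilbert spaces and T : H → K a bounded linear operator. If the m-th singular value of T satisfies s_m(T) > ||T||_e (the essential norm, i.e. the distance from T to the compact operators), then s_m(T) is an eigenvalue of (T*T)^{1/2}. -/

import Mathlib

open MeasureTheory ComplexConjugate

noncomputable section

namespace MeroIdx

variable {H K : Type*} [NormedAddCommGroup H] [InnerProductSpace ℂ H]
  [NormedAddCommGroup K] [InnerProductSpace ℂ K]

/-- `sValue m T` is the `m`-th singular value of `T`, defined as the distance from `T`
to the operators of rank at most `m`. -/
def sValue (m : ℕ) (T : H →L[ℂ] K) : ℝ :=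
  sInf { c : ℝ | ∃ R : H →L[ℂ] K, Module.rank ℂ ↥(LinearMap.range (R : H →ₗ[ℂ] K)) ≤ m ∧ c = ‖T - R‖ }

/-- The essential norm of `T` : the distance from `T` to the compact operators. -/
def essNorm (T : H →L[ℂ] K) : ℝ :=
  sInf { c : ℝ | ∃ S : H →L[ℂ] K, IsCompactOperator S ∧ c = ‖T - S‖ }

lemma sValue_le_of_rank_le {m : ℕ} (T R : H →L[ℂ] K)
    (hR : Module.rank ℂ ↥(LinearMap.range (R : H →ₗ[ℂ] K)) ≤ m) : sValue m T ≤ ‖T - R‖ :=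
  csInf_le ⟨0, by rintro _ ⟨R, -, rfl⟩; positivity⟩ ⟨R, hR, rfl⟩

/-- An operator bounded below by `c` on a subspace of dimension greater than `m` has `m`-th
singular value at least `c`. -/
lemma le_sValue_of_lt_rank {m : ℕ} (T : H →L[ℂ] K) (V : Submodule ℂ H) {c : ℝ}
    (hV : ¬ Module.rank ℂ V ≤ m) (hc : ∀ x ∈ V, c * ‖x‖ ≤ ‖T x‖) : c ≤ sValue m T := by
  refine le_csInf ⟨_, 0, by simp, rfl⟩ ?_
  rintro _ ⟨R, hR, rfl⟩
  have hninj : ¬ Function.Injective ((R : H →ₗ[ℂ] K).rangeRestrict ∘ₗ V.subtype) := fun hinj => by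
    have := LinearMap.lift_rank_le_of_injective _ hinj
    have h2 := this.trans (Cardinal.lift_le.2 hR)
    simp only [Cardinal.lift_natCast] at h2
    exact hV (Cardinal.lift_le_nat_iff.1 h2)
  rw [injective_iff_map_eq_zero] at hninj
  push Not at hninj
  obtain ⟨x, hx, hx0⟩ := hninj
  have hRx : R x = 0 := congrArg Subtype.val hx
  have hpos : 0 < ‖(x : H)‖ := by simpa using hx0
  refine le_of_mul_le_mul_right ?_ hpos
  calc c * ‖(x : H)‖ ≤ ‖T x‖ := hc x x.2
    _ = ‖(T - R) x‖ := by simp [hRx]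
    _ ≤ ‖T - R‖ * ‖(x : H)‖ := (T - R).le_opNorm x

section Complete

variable [CompleteSpace H] [CompleteSpace K]

/-- The operator `T*T - μ²`. -/
def gramSub (T : H →L[ℂ] K) (μ : ℝ) : H →L[ℂ] H :=
  ContinuousLinearMap.adjoint T ∘L T - ((μ ^ 2 : ℝ) : ℂ) • ContinuousLinearMap.id ℂ H

lemma sq_mul_norm_sq_le (T : H →L[ℂ] K) (μ : ℝ) (z : H) :
    μ ^ 2 * ‖z‖ ^ 2 ≤ ‖T z‖ ^ 2 + ‖gramSub T μ z‖ * ‖z‖ := by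
  have h1 : (inner ℂ (gramSub T μ z) z).re = ‖T z‖ ^ 2 - μ ^ 2 * ‖z‖ ^ 2 := by
    have h2 := T.apply_norm_sq_eq_inner_adjoint_left z
    have h3 : inner ℂ (((μ ^ 2 : ℝ) : ℂ) • z) z = ((μ ^ 2 * ‖z‖ ^ 2 : ℝ) : ℂ) := by
      rw [inner_smul_left, inner_self_eq_norm_sq_to_K, Complex.conj_ofReal]
      push_cast
      rfl
    rw [h2]
    simp only [gramSub, sub_apply, smul_apply, ContinuousLinearMap.id_apply,
      inner_sub_left, Complex.sub_re]
    rw [h3, Complex.ofReal_re]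
    rfl
  have h4 := (abs_le.1 ((Complex.abs_re_le_norm _).trans
    (norm_inner_le_norm (𝕜 := ℂ) (gramSub T μ z) z))).1
  linarith

/-- Above the essential norm, `T*T - μ²` is bounded below up to a compact operator. -/
lemma norm_le_of_norm_sub_lt (T S : H →L[ℂ] K) {μ : ℝ} (h : ‖T - S‖ < μ) (z : H) :
    ‖z‖ ≤ (2 * ‖T - S‖ + ‖S‖ + 1) / (μ ^ 2 - ‖T - S‖ ^ 2) * ‖(S.prod (gramSub T μ)) z‖ := by
  set r := ‖T - S‖ with hr
  have hr0 : 0 ≤ r := norm_nonneg _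
  have hd : 0 < μ ^ 2 - r ^ 2 := by nlinarith
  rcases eq_or_ne z 0 with rfl | hz
  · simp
  have hz0 : 0 < ‖z‖ := norm_pos_iff.2 hz
  have h1 := sq_mul_norm_sq_le T μ z
  have h2 : ‖T z‖ ≤ r * ‖z‖ + ‖S z‖ := by
    calc ‖T z‖ = ‖(T - S) z + S z‖ := by simp
      _ ≤ _ := (norm_add_le _ _).trans (by gcongr; exact (T - S).le_opNorm z)
  have h3 : ‖S z‖ ≤ ‖S‖ * ‖z‖ := S.le_opNorm z
  have h4 : ‖S z‖ ≤ ‖(S.prod (gramSub T μ)) z‖ := norm_fst_le ((S z, gramSub T μ z) : K × H)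
  have h5 : ‖gramSub T μ z‖ ≤ ‖(S.prod (gramSub T μ)) z‖ :=
    norm_snd_le ((S z, gramSub T μ z) : K × H)
  set p := ‖(S.prod (gramSub T μ)) z‖
  have h6 : ‖T z‖ ^ 2 ≤ (r * ‖z‖ + ‖S z‖) ^ 2 := by gcongr
  rw [div_mul_eq_mul_div, le_div_iff₀ hd]
  refine le_of_mul_le_mul_right ?_ hz0
  have h7 : ‖S z‖ * ‖S z‖ ≤ ‖S‖ * ‖z‖ * p := by gcongr
  have h8 : r * ‖z‖ * ‖S z‖ ≤ r * ‖z‖ * p := by gcongr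
  have h9 : ‖gramSub T μ z‖ * ‖z‖ ≤ p * ‖z‖ := by gcongr
  nlinarith

lemma exists_mul_norm_le_gramSub (T : H →L[ℂ] K) {μ : ℝ} (h : essNorm T < μ)
    (hker : ∀ x, gramSub T μ x = 0 → x = 0) : ∃ c > 0, ∀ x, c * ‖x‖ ≤ ‖gramSub T μ x‖ := by
  rw [essNorm] at h
  obtain ⟨_, ⟨S, hS, rfl⟩, hlt⟩ := exists_lt_of_csInf_lt
    (by exact ⟨_, 0, isCompactOperator_zero, rfl⟩) h
  have hbound := norm_le_of_norm_sub_lt T S hlt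
  set C := (2 * ‖T - S‖ + ‖S‖ + 1) / (μ ^ 2 - ‖T - S‖ ^ 2)
  set P := S.prod (gramSub T μ)
  by_contra! hcon
  have hunit : ∀ n : ℕ, ∃ u : H, ‖u‖ = 1 ∧ ‖gramSub T μ u‖ ≤ 1 / ((n : ℝ) + 1) := fun n => by
    obtain ⟨x, hx⟩ := hcon (1 / ((n : ℝ) + 1)) (by positivity)
    have hx0 : x ≠ 0 := by rintro rfl; simp at hx
    have hn : ‖x‖ ≠ 0 := norm_ne_zero_iff.2 hx0
    refine ⟨((‖x‖⁻¹ : ℝ) : ℂ) • x, by simp [norm_smul, hn], ?_⟩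
    rw [map_smul, norm_smul, Complex.norm_real, norm_inv, norm_norm, inv_mul_le_iff₀ (by positivity)]
    linarith
  choose u hu1 hu using hunit
  obtain ⟨y, -, φ, hφ, hy⟩ :=
    (hS.isCompact_closure_image_closedBall (f := (S : H →ₗ[ℂ] K)) 1).tendsto_subseq
      (x := fun n => S (u n))
      fun n => subset_closure ⟨u n, by simp [hu1 n], rfl⟩
  have hDu : Filter.Tendsto (fun n => gramSub T μ (u (φ n))) Filter.atTop (nhds 0) :=
    (squeeze_zero_norm hu tendsto_one_div_add_atTop_nhds_zero_nat).comp hφ.tendsto_atTop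
  have hP : Filter.Tendsto (fun n => P (u (φ n))) Filter.atTop (nhds (y, 0)) :=
    hy.prodMk_nhds hDu
  have hC : 0 ≤ C := by
    have : 0 < μ ^ 2 - ‖T - S‖ ^ 2 := by nlinarith [norm_nonneg (T - S)]
    positivity
  have hanti : AntilipschitzWith ⟨C, hC⟩ P :=
    AddMonoidHomClass.antilipschitz_of_bound P hbound
  obtain ⟨x, hx⟩ := (hanti.isClosed_range P.uniformContinuous).mem_of_tendsto hP
    (Filter.Eventually.of_forall fun n => ⟨_, rfl⟩)
  have hx0 : x = 0 := hker x (congrArg Prod.snd hx)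
  rw [← hx, hx0, map_zero] at hP
  have h0 : Filter.Tendsto (fun n => C * ‖P (u (φ n))‖) Filter.atTop (nhds 0) := by
    simpa using hP.norm.const_mul C
  exact absurd (ge_of_tendsto' h0 fun n => (hu1 (φ n)).ge.trans (hbound _)) (by norm_num)

lemma adjoint_gramSub (T : H →L[ℂ] K) (μ : ℝ) :
    ContinuousLinearMap.adjoint (gramSub T μ) = gramSub T μ := by
  simp [gramSub, ContinuousLinearMap.adjoint_comp, map_smulₛₗ, ContinuousLinearMap.adjoint_id]

lemma isUnit_gramSub (T : H →L[ℂ] K) {μ : ℝ} (h : essNorm T < μ)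
    (hker : ∀ x, gramSub T μ x = 0 → x = 0) : IsUnit (gramSub T μ) := by
  rw [ContinuousLinearMap.isUnit_iff_bijective,
    ContinuousLinearMap.bijective_iff_dense_range_and_antilipschitz]
  constructor
  · rw [Submodule.topologicalClosure_eq_top_iff, ContinuousLinearMap.orthogonal_range,
      adjoint_gramSub]
    exact (Submodule.eq_bot_iff _).2 hker
  · exact antilipschitzWith_iff_exists_mul_le_norm.2 (exists_mul_norm_le_gramSub T h hker)

/-- An eigenvector of a positive operator `a` with eigenvalue `μ²` is an eigenvector of its square
root with eigenvalue `μ`. -/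
lemma sqrt_apply_eq_smul {a : H →L[ℂ] H} (ha : 0 ≤ a) {μ : ℝ} (hμ : 0 < μ) {x : H}
    (hx : a x = ((μ ^ 2 : ℝ) : ℂ) • x) : CFC.sqrt a x = (μ : ℂ) • x := by
  set P := CFC.sqrt a
  have hPP : P (P x) = a x := congrArg (fun b : H →L[ℂ] H => b x) (CFC.sqrt_mul_sqrt_self a)
  have hP : P.IsPositive := (ContinuousLinearMap.nonneg_iff_isPositive P).1 (CFC.sqrt_nonneg a)
  set y := P x - (μ : ℂ) • x with hy
  have hPy : P y = -((μ : ℂ) • y) := by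
    rw [hy, map_sub, map_smul, hPP, hx, smul_sub, smul_smul]
    push_cast
    rw [sq]
    abel
  have h1 := hP.re_inner_nonneg_left y
  rw [hPy, inner_neg_left, inner_smul_left, inner_self_eq_norm_sq_to_K, Complex.conj_ofReal] at h1
  have h2 : 0 ≤ -(μ * ‖y‖ ^ 2) := by
    have h3 : -((μ : ℂ) * (‖y‖ : ℂ) ^ 2) = ((-(μ * ‖y‖ ^ 2) : ℝ) : ℂ) := by push_cast; rfl
    exact (h1.trans_eq (congrArg Complex.re h3)).trans_eq (Complex.ofReal_re _)
  have h3 : ‖y‖ = 0 := by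
    by_contra h
    have : 0 < μ * ‖y‖ ^ 2 := by positivity
    linarith
  exact sub_eq_zero.1 (norm_eq_zero.1 h3)

/-- The square of a positive singular value belongs to the spectrum of `T*T`. -/
lemma sValue_sq_mem_spectrum (T : H →L[ℂ] K) (m : ℕ) (hpos : 0 < sValue m T) :
    sValue m T ^ 2 ∈ spectrum ℝ (ContinuousLinearMap.adjoint T ∘L T) := by
  by_contra hs
  set s := sValue m T
  set a : H →L[ℂ] H := ContinuousLinearMap.adjoint T ∘L T
  have ha : IsSelfAdjoint a := T.isPositive_adjoint_comp_self.isSelfAdjoint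
  obtain ⟨δ, hδ, hball⟩ := Metric.isOpen_iff.1 (spectrum.isClosed (𝕜 := ℝ) a).isOpen_compl _ hs
  have hgap : ∀ t ∈ spectrum ℝ a, δ ≤ |t - s ^ 2| := fun t ht => by
    by_contra! hlt
    exact hball (by simpa [Real.dist_eq] using hlt) ht
  set f : ℝ → ℝ := fun t => if s ^ 2 < t then 1 else 0 with hf
  have hcont : ContinuousOn f (spectrum ℝ a) := by
    intro t ht
    have hne : t ≠ s ^ 2 := fun h => hs (h ▸ ht)
    refine ContinuousAt.continuousWithinAt ?_
    rcases lt_or_gt_of_ne hne with h | h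
    · refine (continuousAt_const (y := (0 : ℝ))).congr ?_
      filter_upwards [eventually_lt_nhds h] with x hx
      simp [hf, hx.not_gt]
    · refine (continuousAt_const (y := (1 : ℝ))).congr ?_
      filter_upwards [eventually_gt_nhds h] with x hx
      simp [hf, hx]
  set E := cfc f a with hE
  have hEsa : IsSelfAdjoint E := cfc_predicate f a
  have hEE : E * E = E := by
    rw [hE, ← cfc_mul f f a hcont hcont]
    congr 1
    funext t
    by_cases h : s ^ 2 < t <;> simp [hf, h]
  have haE : a * E = cfc (fun t => t * f t) a := by
    rw [cfc_mul (fun t => t) f a continuousOn_id hcont, cfc_id' ℝ a]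
  have hoff : ‖T - T ∘L E‖ < s := by
    have h1 : a - a * E = cfc (fun t => t - t * f t) a := by
      rw [haE, cfc_sub (fun t => t) (fun t => t * f t) a continuousOn_id
        (continuousOn_id.mul hcont), cfc_id' ℝ a]
    have hcomm : E * a = a * E := by
      have := congrArg star haE
      rw [star_mul, hEsa.star_eq, ha.star_eq] at this
      rw [this, haE]
      exact (cfc_predicate (fun t => t * f t) a : IsSelfAdjoint _).star_eq
    have h2 : ContinuousLinearMap.adjoint (T - T ∘L E) ∘L (T - T ∘L E) = a - a * E := by
      have h3 : T - T ∘L E = T ∘L (1 - E) := by ext; simp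
      have h4 : ContinuousLinearMap.adjoint (1 - E) = 1 - E :=
        ((IsSelfAdjoint.one _).sub hEsa).star_eq
      rw [h3, ContinuousLinearMap.adjoint_comp, h4]
      change (1 - E) * (a * (1 - E)) = _
      rw [mul_sub, mul_one, sub_mul, one_mul, mul_sub, ← mul_assoc E a E, hcomm, mul_assoc a E E, hEE,
        sub_self, sub_zero]
    have h3 : ‖a - a * E‖ ≤ max 0 (s ^ 2 - δ) := by
      rw [h1]
      refine norm_cfc_le (le_max_left _ _) fun t ht => ?_
      have ht0 : 0 ≤ t := spectrum_nonneg_of_nonneg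
        ((ContinuousLinearMap.nonneg_iff_isPositive a).2 T.isPositive_adjoint_comp_self) ht
      by_cases h : s ^ 2 < t
      · simp [hf, h]
      · have := hgap t ht
        rw [abs_of_nonpos (by linarith)] at this
        simp only [hf, h, if_false, mul_zero, sub_zero, Real.norm_eq_abs, abs_of_nonneg ht0]
        exact le_max_of_le_right (by linarith)
    have h4 : ‖T - T ∘L E‖ * ‖T - T ∘L E‖ < s ^ 2 := by
      rw [← ContinuousLinearMap.norm_adjoint_comp_self, h2]
      exact h3.trans_lt (max_lt (by positivity) (by linarith))
    exact lt_of_pow_lt_pow_left₀ 2 hpos.le (by rwa [sq])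
  have hrank : ¬ Module.rank ℂ ↥(LinearMap.range (E : H →ₗ[ℂ] H)) ≤ m := fun hle => by
    refine (sValue_le_of_rank_le T (T ∘L E) ?_).not_gt hoff
    have h1 : LinearMap.range ((T ∘L E : H →L[ℂ] K) : H →ₗ[ℂ] K) =
        (LinearMap.range (E : H →ₗ[ℂ] H)).map (T : H →ₗ[ℂ] K) := LinearMap.range_comp _ _
    rw [h1]
    have h2 := (lift_rank_map_le (T : H →ₗ[ℂ] K) (LinearMap.range (E : H →ₗ[ℂ] H))).trans
      (Cardinal.lift_le.2 hle)
    rw [Cardinal.lift_natCast] at h2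
    exact Cardinal.lift_le_nat_iff.1 h2
  have hon : ∀ x ∈ LinearMap.range (E : H →ₗ[ℂ] H), √(s ^ 2 + δ) * ‖x‖ ≤ ‖T x‖ := by
    rintro _ ⟨w, rfl⟩
    set x := E w with hx
    have hEx : E x = x := congrArg (fun b : H →L[ℂ] H => b w) hEE
    have h1 : (s ^ 2 + δ) • E ≤ a * E := by
      rw [haE, hE, ← cfc_const_mul _ f a hcont]
      refine cfc_mono (fun t ht => ?_) (continuousOn_const.mul hcont) (continuousOn_id.mul hcont)
      by_cases h : s ^ 2 < t
      · have := hgap t ht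
        rw [abs_of_pos (by linarith)] at this
        simp only [hf, h, if_true, mul_one]
        linarith
      · simp [hf, h]
    have h2 := ((ContinuousLinearMap.le_def _ _).1 h1).re_inner_nonneg_left x
    have h3 : (a * E - (s ^ 2 + δ) • E) x = a x - ((s ^ 2 + δ : ℝ) : ℂ) • x := by
      change a (E x) - (s ^ 2 + δ) • E x = _
      rw [hEx, Complex.coe_smul]
    rw [h3, inner_sub_left, inner_smul_left, inner_self_eq_norm_sq_to_K, Complex.conj_ofReal,
      map_sub] at h2
    have h4 : (s ^ 2 + δ) * ‖x‖ ^ 2 ≤ ‖T x‖ ^ 2 := by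
      rw [T.apply_norm_sq_eq_inner_adjoint_left x]
      have h5 : RCLike.re (((s ^ 2 + δ : ℝ) : ℂ) * ((‖x‖ : ℂ) ^ 2)) = (s ^ 2 + δ) * ‖x‖ ^ 2 := by
        rw [← Complex.ofReal_pow, ← Complex.ofReal_mul]
        exact Complex.ofReal_re _
      rw [← h5]
      exact sub_nonneg.1 h2
    refine le_of_sq_le_sq ?_ (norm_nonneg _)
    rwa [mul_pow, Real.sq_sqrt (by positivity)]
  have hle : √(s ^ 2 + δ) ≤ s := le_sValue_of_lt_rank T _ hrank hon
  rw [Real.sqrt_le_left hpos.le] at hle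
  linarith

end Complete

/-- If the `m`-th singular value of a bounded operator `T` between Hilbert
spaces exceeds its essential norm, then `s_m(T)` is an eigenvalue of `(T*T)^{1/2}`. -/
theorem singularValue_eigenvalue_of_essNorm_lt
    {H K : Type*} [NormedAddCommGroup H] [InnerProductSpace ℂ H] [CompleteSpace H]
    [NormedAddCommGroup K] [InnerProductSpace ℂ K] [CompleteSpace K]
    (T : H →L[ℂ] K) (m : ℕ) (h : essNorm T < sValue m T) :
    ∃ x : H, x ≠ 0 ∧
      CFC.sqrt (ContinuousLinearMap.adjoint T ∘L T) x = (sValue m T : ℂ) • x := by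
  have hess : 0 ≤ essNorm T := Real.sInf_nonneg (by rintro _ ⟨S, -, rfl⟩; positivity)
  have hpos : 0 < sValue m T := hess.trans_lt h
  by_contra! hne
  have ha : (0 : H →L[ℂ] H) ≤ ContinuousLinearMap.adjoint T ∘L T :=
    (ContinuousLinearMap.nonneg_iff_isPositive _).2 T.isPositive_adjoint_comp_self
  refine spectrum.mem_iff.1 (sValue_sq_mem_spectrum T m hpos) ?_
  have hunit := isUnit_gramSub T h fun x hx => by
    by_contra hx0
    exact hne x hx0 (sqrt_apply_eq_smul ha hpos (sub_eq_zero.1 hx))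
  rw [← IsUnit.neg_iff]
  convert hunit using 1
  ext x
  simp [gramSub, Algebra.algebraMap_eq_smul_one, ← Complex.coe_smul]

end MeroIdx
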